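/- Suppose 1, θ₁, …, θₙ are linearly independent over ℚ, ω < ∞, and λ̂ < 1. Then ω/ω̂ ≥ (1 − ω̂^{−1})/(1 − λ̂). -/

import Mathlib

open scoped ENNReal


/-- Solvability of the simultaneous approximation system
`max_{1≤i≤n} |x₀θᵢ - xᵢ| ≤ t^{-γ}`, `0 < |x₀| ≤ t` in integers. -/
def SimSolvable (n : ℕ) (θ : Fin n → ℝ) (γ t : ℝ) : Prop :=
  ∃ x : Fin (n+1) → ℤ, x 0 ≠ 0 ∧ (|x 0| : ℝ) ≤ t ∧
    ∀ i : Fin n, |(x 0 : ℝ) * θ i - (x i.succ : ℝ)| ≤ t ^ (-γ)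

/-- Solvability of the linear form system
`|x₀ + θ₁x₁ + … + θₙxₙ| ≤ t^{-γ}`, `0 < max_{1≤i≤n} |xᵢ| ≤ t` in integers. -/
def LinSolvable (n : ℕ) (θ : Fin n → ℝ) (γ t : ℝ) : Prop :=
  ∃ x : Fin (n+1) → ℤ, (∃ i : Fin n, x i.succ ≠ 0) ∧ (∀ i : Fin n, (|x i.succ| : ℝ) ≤ t) ∧
    |(x 0 : ℝ) + ∑ i : Fin n, θ i * (x i.succ : ℝ)| ≤ t ^ (-γ)

/-- The regular simultaneous Diophantine exponent `λ(θ) ∈ [0,∞]`. -/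
noncomputable def lambdaExp (n : ℕ) (θ : Fin n → ℝ) : ℝ≥0∞ :=
  sSup {e : ℝ≥0∞ | ∃ γ : ℝ, 0 < γ ∧ e = ENNReal.ofReal γ ∧
    ∀ T : ℝ, ∃ t : ℝ, T < t ∧ SimSolvable n θ γ t}

/-- The uniform simultaneous Diophantine exponent `λ̂(θ) ∈ [0,∞]`. -/
noncomputable def lambdaHatExp (n : ℕ) (θ : Fin n → ℝ) : ℝ≥0∞ :=
  sSup {e : ℝ≥0∞ | ∃ γ : ℝ, 0 < γ ∧ e = ENNReal.ofReal γ ∧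
    ∃ T : ℝ, ∀ t : ℝ, T < t → SimSolvable n θ γ t}

/-- The regular linear form Diophantine exponent `ω(θ) ∈ [0,∞]`. -/
noncomputable def omegaExp (n : ℕ) (θ : Fin n → ℝ) : ℝ≥0∞ :=
  sSup {e : ℝ≥0∞ | ∃ γ : ℝ, 0 < γ ∧ e = ENNReal.ofReal γ ∧
    ∀ T : ℝ, ∃ t : ℝ, T < t ∧ LinSolvable n θ γ t}

/-- The uniform linear form Diophantine exponent `ω̂(θ) ∈ [0,∞]`. -/
noncomputable def omegaHatExp (n : ℕ) (θ : Fin n → ℝ) : ℝ≥0∞ :=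
  sSup {e : ℝ≥0∞ | ∃ γ : ℝ, 0 < γ ∧ e = ENNReal.ofReal γ ∧
    ∃ T : ℝ, ∀ t : ℝ, T < t → LinSolvable n θ γ t}
/-- The linear form `x₀ + θ₁x₁ + … + θₙxₙ`. -/
noncomputable def linForm (n : ℕ) (θ : Fin n → ℝ) (x : Fin (n+1) → ℤ) : ℝ :=
  (x 0 : ℝ) + ∑ i : Fin n, θ i * (x i.succ : ℝ)

/-- The standard integer bilinear form on `ℤ^{n+1}`. -/
def pairing (n : ℕ) (y x : Fin (n+1) → ℤ) : ℤ :=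
  y 0 * x 0 + ∑ i : Fin n, y i.succ * x i.succ

/-- The defect `∑ (y₀θᵢ - yᵢ)xᵢ` between `y₀` times the linear form at `x` and the pairing. -/
noncomputable def defect (n : ℕ) (θ : Fin n → ℝ) (y x : Fin (n+1) → ℤ) : ℝ :=
  ∑ i : Fin n, ((y 0 : ℝ) * θ i - (y i.succ : ℝ)) * (x i.succ : ℝ)

theorem pairing_eq (n : ℕ) (θ : Fin n → ℝ) (y x : Fin (n+1) → ℤ) :
    (pairing n y x : ℝ) = y 0 * linForm n θ x - defect n θ y x := by
  simp only [pairing, linForm, defect, sub_mul, Finset.sum_sub_distrib, mul_add, Finset.mul_sum]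
  push_cast
  simp only [mul_assoc]
  ring

theorem abs_defect_le {n : ℕ} {θ : Fin n → ℝ} {y x : Fin (n+1) → ℤ} {M X : ℝ} (hM : 0 ≤ M)
    (hy : ∀ i : Fin n, |(y 0 : ℝ) * θ i - (y i.succ : ℝ)| ≤ M)
    (hx : ∀ i : Fin n, (|x i.succ| : ℝ) ≤ X) :
    |defect n θ y x| ≤ n * (M * X) := by
  unfold defect
  refine (Finset.abs_sum_le_sum_abs _ _).trans ?_
  refine (Finset.sum_le_sum (g := fun _ => M * X) fun i _ => ?_).trans (by simp)
  rw [abs_mul]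
  exact mul_le_mul (hy i) (hx i) (abs_nonneg _) hM

theorem linForm_ne_zero {n : ℕ} {θ : Fin n → ℝ}
    (hindep : LinearIndependent ℚ (Fin.cons 1 θ : Fin (n+1) → ℝ)) {x : Fin (n+1) → ℤ}
    (hx : ∃ i : Fin n, x i.succ ≠ 0) : linForm n θ x ≠ 0 := by
  intro h
  obtain ⟨i, hi⟩ := hx
  have := Fintype.linearIndependent_iff.1 hindep (fun j => (x j : ℚ)) (by
    rw [Fin.sum_univ_succ, ← h]
    simp [linForm, Rat.smul_def, mul_comm]) i.succ
  exact hi (by exact_mod_cast this)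

theorem one_le_abs_pairing {n : ℕ} {y x : Fin (n+1) → ℤ} (h : pairing n y x ≠ 0) :
    (1 : ℝ) ≤ |(pairing n y x : ℝ)| := by
  exact_mod_cast Int.one_le_abs h

/-- If `y` is orthogonal to `x'` but not to `x`, the values of the linear form at `x` and `x'`
are constrained by the defects. -/
theorem abs_linForm_le_of_pairing {n : ℕ} (θ : Fin n → ℝ) {y x x' : Fin (n+1) → ℤ}
    (h : pairing n y x ≠ 0) (h' : pairing n y x' = 0) :
    |linForm n θ x'| ≤
      |linForm n θ x| * |defect n θ y x'| + |linForm n θ x'| * |defect n θ y x| := by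
  have e := pairing_eq n θ y x
  have e' := pairing_eq n θ y x'
  rw [h', Int.cast_zero] at e'
  have key : linForm n θ x' * pairing n y x
      = linForm n θ x * defect n θ y x' - linForm n θ x' * defect n θ y x := by
    rw [e]; linear_combination linForm n θ x * -e'
  calc |linForm n θ x'| ≤ |linForm n θ x'| * |(pairing n y x : ℝ)| :=
        le_mul_of_one_le_right (abs_nonneg _) (one_le_abs_pairing h)
    _ = |linForm n θ x * defect n θ y x' - linForm n θ x' * defect n θ y x| := by
        rw [← abs_mul, key]
    _ ≤ _ := (abs_sub _ _).trans (by rw [abs_mul, abs_mul])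

theorem eventually_const_mul_rpow_lt (C : ℝ) {a b : ℝ} (ha : 0 < a) (hb : 0 < b) :
    ∀ᶠ d : ℝ in nhdsWithin 0 (Set.Ioi 0), C * d ^ a < b := by
  have h : Filter.Tendsto (fun d : ℝ => C * d ^ a) (nhds 0) (nhds (C * 0 ^ a)) :=
    ((Real.continuousAt_rpow_const 0 a (Or.inr ha.le)).tendsto).const_mul C
  rw [Real.zero_rpow ha.ne', mul_zero] at h
  exact (h.mono_left nhdsWithin_le_nhds).eventually (gt_mem_nhds hb)

theorem eventually_lt_rpow_neg (T : ℝ) {a : ℝ} (ha : 0 < a) :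
    ∀ᶠ d : ℝ in nhdsWithin 0 (Set.Ioi 0), T < d ^ (-a) :=
  (tendsto_rpow_neg_nhdsGT_zero (neg_lt_zero.2 ha)).eventually_gt_atTop T

theorem exists_step {P : ℕ → Prop} (h0 : ¬ P 0) {K : ℕ} (hK : P K) :
    ∃ k < K, ¬ P k ∧ P (k+1) := by
  induction K with
  | zero => exact absurd hK h0
  | succ K ih =>
    by_cases h : P K
    · obtain ⟨k, hk, h⟩ := ih h
      exact ⟨k, hk.trans K.lt_succ_self, h⟩
    · exact ⟨K, K.lt_succ_self, h, hK⟩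

/-- Iterating the solution of the uniform linear form system, each time asking for half of the
previous value of the form. -/
theorem exists_approximation_sequence {n : ℕ} {θ : Fin n → ℝ}
    (hindep : LinearIndependent ℚ (Fin.cons 1 θ : Fin (n+1) → ℝ)) {ω δ : ℝ} (hδ : 0 < δ)
    (hω : 0 < ω)
    (hl : ∀ d : ℝ, 0 < d → d ≤ δ → LinSolvable n θ ω (d ^ (-(1/ω)))) :
    ∃ (d : ℕ → ℝ) (x : ℕ → Fin (n+1) → ℤ), Antitone d ∧
      Filter.Tendsto d Filter.atTop (nhds 0) ∧ ∀ k, 0 < d k ∧ d k ≤ δ ∧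
        (∃ i : Fin n, x k i.succ ≠ 0) ∧ (∀ i : Fin n, (|x k i.succ| : ℝ) ≤ d k ^ (-(1/ω))) ∧
        |linForm n θ (x k)| ≤ d k ∧ |linForm n θ (x k)| = 2 * d (k+1) := by
  have hx : ∀ d : ℝ, ∃ x : Fin (n+1) → ℤ, 0 < d → d ≤ δ → (∃ i : Fin n, x i.succ ≠ 0) ∧
      (∀ i : Fin n, (|x i.succ| : ℝ) ≤ d ^ (-(1/ω))) ∧ |linForm n θ x| ≤ d := by
    intro d
    by_cases h : 0 < d ∧ d ≤ δ
    · obtain ⟨x, h1, h2, h3⟩ := hl d h.1 h.2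
      refine ⟨x, fun _ _ => ⟨h1, h2, h3.trans_eq ?_⟩⟩
      rw [← Real.rpow_mul h.1.le]
      simp [hω.ne']
    · exact ⟨0, fun a b => absurd ⟨a, b⟩ h⟩
  choose x hx using hx
  let d : ℕ → ℝ := fun k => Nat.rec δ (fun _ c => |linForm n θ (x c)| / 2) k
  have hd : ∀ k, d (k+1) = |linForm n θ (x (d k))| / 2 := fun _ => rfl
  have hpos : ∀ k, 0 < d k ∧ d k ≤ δ := by
    intro k
    induction k with
    | zero => exact ⟨hδ, le_rfl⟩
    | succ k ih =>
      obtain ⟨h1, -, h3⟩ := hx _ ih.1 ih.2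
      have := abs_pos.2 (linForm_ne_zero hindep h1)
      rw [hd]
      constructor <;> linarith [ih.1, ih.2]
  have hhalf : ∀ k, d (k+1) ≤ d k / 2 := by
    intro k
    rw [hd]
    linarith [(hx _ (hpos k).1 (hpos k).2).2.2]
  have hgeom : ∀ k, d k ≤ δ * (1/2) ^ k := by
    intro k
    induction k with
    | zero => simp [d]
    | succ k ih => rw [pow_succ]; linarith [hhalf k]
  refine ⟨d, fun k => x (d k), antitone_nat_of_succ_le fun k => ?_, ?_, fun k => ?_⟩
  · linarith [hhalf k, (hpos k).1]
  · refine squeeze_zero (fun k => (hpos k).1.le) hgeom ?_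
    simpa using (tendsto_pow_atTop_nhds_zero_of_lt_one (by norm_num : (0:ℝ) ≤ 1/2)
      (by norm_num)).const_mul δ
  · obtain ⟨h1, h2, h3⟩ := hx _ (hpos k).1 (hpos k).2
    exact ⟨(hpos k).1, (hpos k).2, h1, h2, h3, by rw [hd]; ring⟩

theorem linSolvable_of_uniform {n : ℕ} {θ : Fin n → ℝ}
    (hindep : LinearIndependent ℚ (Fin.cons 1 θ : Fin (n+1) → ℝ)) {l ω ρ : ℝ}
    (hl0 : 0 < l) (hl1 : l < 1) (hlω : 1 < l * ω) (hρ : ρ * (1 - l) < ω - 1)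
    (hsim : ∃ T : ℝ, ∀ t : ℝ, T < t → SimSolvable n θ l t)
    (hlin : ∃ T : ℝ, ∀ t : ℝ, T < t → LinSolvable n θ ω t) :
    ∀ T : ℝ, ∃ t : ℝ, T < t ∧ LinSolvable n θ ρ t := by
  intro T
  obtain ⟨T₁, hsim⟩ := hsim
  obtain ⟨T₂, hlin⟩ := hlin
  have hω : 0 < ω := by
    by_contra! h
    nlinarith
  have ha : 0 < 1 / ω := by positivity
  have hb : 0 < l - 1 / ω := by
    rw [sub_pos, div_lt_iff₀ hω]; exact hlω
  have he : 0 < (ω - 1 - ρ * (1 - l)) / ω := div_pos (by linarith) hω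
  obtain ⟨δ, hδ, hsmall⟩ : ∃ δ > 0, ∀ d : ℝ, 0 < d → d ≤ δ →
      T < d ^ (-(1/ω)) ∧ T₂ < d ^ (-(1/ω)) ∧ T₁ < (2 * d)⁻¹ ∧
      n * 2 ^ l * d ^ (l - 1/ω) < 1/2 ∧
      3 * n * 2 ^ l * d ^ ((ω - 1 - ρ * (1 - l)) / ω) < 1 := by
    have h := (eventually_lt_rpow_neg T ha).and <| (eventually_lt_rpow_neg T₂ ha).and <|
      (eventually_lt_rpow_neg (2 * T₁) one_pos).and <|
      (eventually_const_mul_rpow_lt (n * 2 ^ l) hb one_half_pos).and <|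
      eventually_const_mul_rpow_lt (3 * n * 2 ^ l) he one_pos
    obtain ⟨δ, hδ, h⟩ := mem_nhdsGT_iff_exists_Ioc_subset.1 h
    refine ⟨δ, hδ, fun d h0 h1 => ?_⟩
    obtain ⟨h1, h2, h3, h4, h5⟩ := h ⟨h0, h1⟩
    refine ⟨h1, h2, ?_, h4, h5⟩
    rw [Real.rpow_neg_one] at h3
    rw [mul_inv]
    linarith
  obtain ⟨d, x, hanti, hlim, hd⟩ := exists_approximation_sequence hindep hδ hω
    fun d h0 h1 => hlin _ (hsmall d h0 h1).2.1
  have hL : ∀ k, 0 < |linForm n θ (x k)| := fun k => by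
    rw [(hd k).2.2.2.2.2]; linarith [(hd (k+1)).1]
  obtain ⟨K, hK⟩ : ∃ K, n * (4 ^ l * d 0 ^ (-(1/ω))) * d (K+1) ^ l < |linForm n θ (x 0)| := by
    have h : Filter.Tendsto (fun k => d (k+1)) Filter.atTop (nhdsWithin 0 (Set.Ioi 0)) :=
      tendsto_nhdsWithin_iff.2 ⟨hlim.comp (Filter.tendsto_add_atTop_nat 1),
        Filter.Eventually.of_forall fun k => (hd _).1⟩
    exact (h.eventually (eventually_const_mul_rpow_lt _ hl0 (hL 0))).exists
  set t : ℝ := (2 * |linForm n θ (x K)|)⁻¹ with ht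
  have htpos : 0 < t := inv_pos.2 (by linarith [hL K])
  have htM : t ^ (-l) = (2 * |linForm n θ (x K)|) ^ l := by
    rw [ht, Real.inv_rpow (by positivity), Real.rpow_neg (by positivity), inv_inv]
  have hM0 : 0 ≤ t ^ (-l) := by positivity
  obtain ⟨y, hy0, hyt, hy⟩ : SimSolvable n θ l t := by
    refine hsim _ ((hsmall (d K) (hd K).1 (hd K).2.1).2.2.1.trans_le ?_)
    exact inv_anti₀ (by linarith [hL K]) (by linarith [(hd K).2.2.2.2.1])
  have hdef := fun k => abs_defect_le hM0 hy (hd k).2.2.2.1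
  have hK0 : pairing n y (x K) = 0 := by
    by_contra h
    have h1 := one_le_abs_pairing h
    rw [pairing_eq n θ] at h1
    have h2 : |(y 0 : ℝ) * linForm n θ (x K)| ≤ 1/2 := by
      rw [abs_mul]
      calc _ ≤ t * |linForm n θ (x K)| := by gcongr
        _ = 1/2 := by
          rw [ht]
          have := (hL K).ne'
          field_simp
    have h3 : |defect n θ y (x K)| < 1/2 := by
      refine lt_of_le_of_lt ?_ (hsmall (d K) (hd K).1 (hd K).2.1).2.2.2.1
      refine (hdef K).trans ?_
      have h4 : (2 * |linForm n θ (x K)|) ^ l ≤ 2 ^ l * d K ^ l := by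
        rw [← Real.mul_rpow (by norm_num) (hd K).1.le]
        exact Real.rpow_le_rpow (by positivity) (by linarith [(hd K).2.2.2.2.1]) hl0.le
      rw [htM, sub_eq_add_neg, Real.rpow_add (hd K).1]
      have h5 : 0 ≤ d K ^ (-(1/ω)) := Real.rpow_nonneg (hd K).1.le _
      calc _ ≤ n * ((2 ^ l * d K ^ l) * d K ^ (-(1/ω))) := by gcongr
        _ = _ := by ring
    linarith [abs_sub ((y 0 : ℝ) * linForm n θ (x K)) (defect n θ y (x K))]
  have h00 : ¬ pairing n y (x 0) = 0 := by
    intro h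
    have e := pairing_eq n θ y (x 0)
    rw [h, Int.cast_zero] at e
    have h1 : |linForm n θ (x 0)| ≤ |defect n θ y (x 0)| := by
      rw [← sub_eq_zero.1 e.symm, abs_mul]
      refine le_mul_of_one_le_left (abs_nonneg _) ?_
      exact_mod_cast Int.one_le_abs hy0
    have h2 := hdef 0
    rw [htM, (hd K).2.2.2.2.2, show 2 * (2 * d (K+1)) = 4 * d (K+1) by ring,
      Real.mul_rpow (by norm_num) (hd (K+1)).1.le] at h2
    have h3 : (n : ℝ) * (4 ^ l * d (K+1) ^ l * d 0 ^ (-(1/ω)))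
      = n * (4 ^ l * d 0 ^ (-(1/ω))) * d (K+1) ^ l := by ring
    linarith
  obtain ⟨k, hkK, hk, hk1⟩ := exists_step (P := fun k => pairing n y (x k) = 0) h00 hK0
  obtain ⟨hp, hpδ, hne, hX, hLd, hLs⟩ := hd (k+1)
  obtain ⟨hs1, -, -, -, hs5⟩ := hsmall _ hp hpδ
  refine ⟨_, hs1, x (k+1), hne, hX, ?_⟩
  change |linForm n θ (x (k+1))| ≤ _
  set D := d (k+1) with hD
  set A := |linForm n θ (x (k+1))| with hA
  have hA0 : 0 < A := hL (k+1)
  have hM : t ^ (-l) ≤ 2 ^ l * A ^ l := by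
    rw [htM, ← Real.mul_rpow (by norm_num) hA0.le]
    refine Real.rpow_le_rpow (by positivity) ?_ hl0.le
    have : d (K+1) ≤ d (k+1+1) := hanti (by omega)
    rw [(hd K).2.2.2.2.2, hLs]
    linarith
  have hmono : d k ^ (-(1/ω)) ≤ D ^ (-(1/ω)) :=
    Real.rpow_le_rpow_of_nonpos hp (hanti k.le_succ) (by linarith)
  have hDr : 0 ≤ D ^ (-(1/ω)) := Real.rpow_nonneg hp.le _
  have hEk : |defect n θ y (x k)| ≤ n * (2 ^ l * A ^ l * D ^ (-(1/ω))) := by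
    refine (hdef k).trans ?_
    have : 0 ≤ d k ^ (-(1/ω)) := Real.rpow_nonneg (hd k).1.le _
    gcongr
  have hEk1 : |defect n θ y (x (k+1))| ≤ n * (2 ^ l * A ^ l * D ^ (-(1/ω))) := by
    refine (hdef (k+1)).trans ?_
    gcongr
  have hmain : A ≤ 3 * n * 2 ^ l * (A ^ l * (D * D ^ (-(1/ω)))) := by
    have h := abs_linForm_le_of_pairing θ hk hk1
    rw [(hd k).2.2.2.2.2, ← hD, ← hA] at h
    calc A ≤ _ := h
      _ ≤ 2 * D * (n * (2 ^ l * A ^ l * D ^ (-(1/ω))))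
          + D * (n * (2 ^ l * A ^ l * D ^ (-(1/ω)))) := by gcongr
      _ = _ := by ring
  have hsplit : D * D ^ (-(1/ω)) =
      D ^ ((ω - 1 - ρ * (1 - l)) / ω) * D ^ (ρ * (1 - l) / ω) := by
    rw [← Real.rpow_add hp, ← Real.rpow_one_add' hp.le]
    · congr 1
      field_simp
      ring
    · have : 1 / ω < 1 := by linarith
      linarith
  have hpow : A ^ (1 - l) ≤ (D ^ (ρ / ω)) ^ (1 - l) := by
    rw [← Real.rpow_mul hp.le, Real.rpow_sub hA0, Real.rpow_one, div_le_iff₀ (by positivity),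
      show ρ / ω * (1 - l) = ρ * (1 - l) / ω by ring]
    have h0 : 0 ≤ D ^ (ρ * (1 - l) / ω) * A ^ l :=
      mul_nonneg (Real.rpow_nonneg hp.le _) (Real.rpow_nonneg hA0.le _)
    calc A ≤ _ := hmain
      _ = (3 * n * 2 ^ l * D ^ ((ω - 1 - ρ * (1 - l)) / ω)) *
          (D ^ (ρ * (1 - l) / ω) * A ^ l) := by rw [hsplit]; ring
      _ ≤ _ := mul_le_of_le_one_left h0 hs5.le
  rw [← Real.rpow_mul hp.le, show -(1/ω) * -ρ = ρ / ω by ring]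
  exact (Real.rpow_le_rpow_iff hA0.le (Real.rpow_nonneg hp.le _) (by linarith)).1 hpow

theorem omegaHatExp_le_omegaExp (n : ℕ) (θ : Fin n → ℝ) : omegaHatExp n θ ≤ omegaExp n θ := by
  refine sSup_le_sSup ?_
  rintro e ⟨γ, h0, he, T, h⟩
  refine ⟨γ, h0, he, fun T' => ⟨max T T' + 1, ?_, h _ ?_⟩⟩
  · linarith [le_max_right T T']
  · linarith [le_max_left T T']

theorem exists_gt_of_lt_sSup_ofReal {P : ℝ → Prop} {c : ℝ}
    (htop : sSup {e : ℝ≥0∞ | ∃ γ : ℝ, 0 < γ ∧ e = ENNReal.ofReal γ ∧ P γ} ≠ ⊤)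
    (h : c < (sSup {e : ℝ≥0∞ | ∃ γ : ℝ, 0 < γ ∧ e = ENNReal.ofReal γ ∧ P γ}).toReal)
    (hc : 0 ≤ c) :
    ∃ γ : ℝ, c < γ ∧
      γ ≤ (sSup {e : ℝ≥0∞ | ∃ γ : ℝ, 0 < γ ∧ e = ENNReal.ofReal γ ∧ P γ}).toReal ∧ P γ := by
  obtain ⟨_, ⟨γ, h0, rfl, hP⟩, hγ⟩ := lt_sSup_iff.1 ((ENNReal.ofReal_lt_iff_lt_toReal hc htop).2 h)
  refine ⟨γ, (ENNReal.ofReal_lt_ofReal_iff h0).1 hγ, ?_, hP⟩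
  exact (ENNReal.ofReal_le_iff_le_toReal htop).1 (le_sSup ⟨γ, h0, rfl, hP⟩)

theorem omegaHat_sub_one_le {n : ℕ} {θ : Fin n → ℝ}
    (hindep : LinearIndependent ℚ (Fin.cons 1 θ : Fin (n+1) → ℝ))
    (hω : omegaExp n θ < ⊤) (hlamhat : lambdaHatExp n θ < 1)
    (h : 1 < (lambdaHatExp n θ).toReal * (omegaHatExp n θ).toReal) :
    (omegaHatExp n θ).toReal - 1 ≤
      (omegaExp n θ).toReal * (1 - (lambdaHatExp n θ).toReal) := by
  have hHtop : omegaHatExp n θ ≠ ⊤ := ((omegaHatExp_le_omegaExp n θ).trans_lt hω).ne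
  have hl1 : (lambdaHatExp n θ).toReal < 1 := by
    simpa using (ENNReal.toReal_lt_toReal hlamhat.ne_top ENNReal.one_ne_top).2 hlamhat
  have hHW : (omegaHatExp n θ).toReal ≤ (omegaExp n θ).toReal :=
    ENNReal.toReal_mono hω.ne (omegaHatExp_le_omegaExp n θ)
  by_contra! hlt
  set H := (omegaHatExp n θ).toReal with hH
  set W := (omegaExp n θ).toReal with hW
  set Λ := (lambdaHatExp n θ).toReal with hΛ
  have hΛ0 : 0 ≤ Λ := ENNReal.toReal_nonneg
  have hH0 : 0 < H := by
    by_contra! hn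
    nlinarith
  have hW0 : 0 < W := hH0.trans_le hHW
  have hc : max (1 / H) (1 - (H - 1) / W) < Λ := by
    refine max_lt ?_ ?_
    · rwa [div_lt_iff₀ hH0]
    · rw [sub_lt_comm, lt_div_iff₀ hW0]; linarith
  obtain ⟨l, hl, hlΛ, hsim⟩ := exists_gt_of_lt_sSup_ofReal hlamhat.ne_top hc
    (le_max_of_le_left (by positivity))
  change l ≤ Λ at hlΛ
  obtain ⟨hlH, hlW⟩ := max_lt_iff.1 hl
  have hl0 : 0 < l := (by positivity : (0:ℝ) < 1 / H).trans hlH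
  have hc' : max (1 / l) (1 + W * (1 - l)) < H := by
    refine max_lt ?_ ?_
    · rw [div_lt_iff₀ hl0]; rw [div_lt_iff₀ hH0] at hlH; linarith
    · rw [sub_lt_comm, lt_div_iff₀ hW0] at hlW; linarith
  obtain ⟨ω, hω', -, hlin⟩ := exists_gt_of_lt_sSup_ofReal hHtop hc'
    (le_max_of_le_left (by positivity))
  obtain ⟨hωl, hωW⟩ := max_lt_iff.1 hω'
  have h1l : 0 < 1 - l := by linarith
  have hlt' : W < (ω - 1) / (1 - l) := by
    rw [lt_div_iff₀ h1l]; linarith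
  obtain ⟨ρ, hρW, hρ⟩ := exists_between hlt'
  rw [lt_div_iff₀ h1l] at hρ
  have hmem := linSolvable_of_uniform hindep hl0 (by linarith)
    (by rw [div_lt_iff₀ hl0] at hωl; linarith) hρ hsim hlin
  have hle : ENNReal.ofReal ρ ≤ omegaExp n θ := le_sSup ⟨ρ, hW0.trans hρW, rfl, hmem⟩
  exact absurd ((ENNReal.ofReal_le_iff_le_toReal hω.ne).1 hle) (not_le.2 hρW)

/-- if `1, θ₁, …, θₙ` are linearly independent over `ℚ`, `ω < ∞` and `λ̂ < 1`,
then `ω/ω̂ ≥ (1 - ω̂⁻¹)/(1 - λ̂)` (with `ω̂⁻¹ = 0` if `ω̂ = ∞`). -/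
theorem stmt5 (n : ℕ) (hn : 2 ≤ n) (θ : Fin n → ℝ)
    (hindep : LinearIndependent ℚ (Fin.cons 1 θ : Fin (n+1) → ℝ))
    (hω : omegaExp n θ < ⊤) (hlamhat : lambdaHatExp n θ < 1) :
    omegaExp n θ / omegaHatExp n θ ≥
      (1 - (omegaHatExp n θ)⁻¹) / (1 - lambdaHatExp n θ) := by
  have hHW := omegaHatExp_le_omegaExp n θ
  have hHtop : omegaHatExp n θ ≠ ⊤ := (hHW.trans_lt hω).ne
  have hl1 : (lambdaHatExp n θ).toReal < 1 := by
    simpa using (ENNReal.toReal_lt_toReal hlamhat.ne_top ENNReal.one_ne_top).2 hlamhat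
  rcases le_or_gt (omegaHatExp n θ) 1 with hH1 | hH1
  · have : 1 - (omegaHatExp n θ)⁻¹ = 0 := tsub_eq_zero_of_le (ENNReal.one_le_inv.2 hH1)
    simp [this]
  have hH0 : omegaHatExp n θ ≠ 0 := (zero_lt_one.trans hH1).ne'
  have hHpos : 0 < (omegaHatExp n θ).toReal := ENNReal.toReal_pos hH0 hHtop
  have hdpos : 1 - lambdaHatExp n θ ≠ 0 := (tsub_pos_of_lt hlamhat).ne'
  have hdtop : 1 - lambdaHatExp n θ ≠ ⊤ := ENNReal.sub_ne_top ENNReal.one_ne_top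
  have hinv : (omegaHatExp n θ)⁻¹ ≤ 1 := ENNReal.inv_le_one.2 hH1.le
  have hLHS : omegaExp n θ / omegaHatExp n θ ≠ ⊤ := ENNReal.div_ne_top hω.ne hH0
  have hRHS : (1 - (omegaHatExp n θ)⁻¹) / (1 - lambdaHatExp n θ) ≠ ⊤ :=
    ENNReal.div_ne_top (ENNReal.sub_ne_top ENNReal.one_ne_top) hdpos
  rw [ge_iff_le, ← ENNReal.toReal_le_toReal hRHS hLHS, ENNReal.toReal_div, ENNReal.toReal_div,
    ENNReal.toReal_sub_of_le hinv ENNReal.one_ne_top,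
    ENNReal.toReal_sub_of_le hlamhat.le ENNReal.one_ne_top, ENNReal.toReal_inv,
    ENNReal.toReal_one]
  have hHW' : (omegaHatExp n θ).toReal ≤ (omegaExp n θ).toReal := ENNReal.toReal_mono hω.ne hHW
  have key : (omegaHatExp n θ).toReal - 1 ≤
      (omegaExp n θ).toReal * (1 - (lambdaHatExp n θ).toReal) := by
    by_cases h : 1 < (lambdaHatExp n θ).toReal * (omegaHatExp n θ).toReal
    · exact omegaHat_sub_one_le hindep hω hlamhat h
    · nlinarith
  rw [div_le_div_iff₀ (by linarith) hHpos]
  calc _ = (omegaHatExp n θ).toReal - 1 := by field_simp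
    _ ≤ _ := key
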